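/- Let Γ={g₁,…,g_k} be a finite set of orientation-preserving circle homeomorphisms that contains two rotations g₁=T_α and g₂=T_β with α−β irrational, and let p=(p₁,…,p_k) be any probability vector with all pᵢ>0. Then (Γ,p) is asymptotically stable: the Markov operator P has a unique invariant Borel probability measure μ* and for every Borel probability measure μ on S¹ and every continuous f, ∫ f d(Pⁿμ) → ∫ f dμ* as n→∞. -/

import Mathlib

open MeasureTheory Filter Topology

noncomputable section

/-- The circle `ℝ/ℤ` with normalized arc length (Haar probability measure as `volume`). -/
abbrev S1 : Type := UnitAddCircle

/-- `h` is an orientation-preserving circle homeomorphism: it admits a strictly increasing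
continuous lift `G : ℝ → ℝ` with `G (t+1) = G t + 1`. -/
def IsOPH (h : S1 ≃ₜ S1) : Prop :=
  ∃ G : ℝ → ℝ, StrictMono G ∧ Continuous G ∧ (∀ t, G (t + 1) = G t + 1) ∧
    ∀ t : ℝ, h ((t : ℝ) : S1) = ((G t : ℝ) : S1)

/-- For a word `w = [i₁, …, i_n]`, `applyWord g w = g_{i_n} ∘ ⋯ ∘ g_{i_1}`. -/
def applyWord {k : ℕ} (g : Fin k → S1 ≃ₜ S1) (w : List (Fin k)) (x : S1) : S1 :=
  w.foldl (fun y i => g i y) x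

/-- `Γ` is admissible: some generator has a dense forward orbit `{gᵢⁿ x : n ≥ 1}`. -/
def Admissible {k : ℕ} (g : Fin k → S1 ≃ₜ S1) : Prop :=
  ∃ i : Fin k, ∃ x : S1, Dense (Set.range fun n : ℕ => (⇑(g i))^[n + 1] x)

/-- The action of `Γ` is contractive: every `x` has an open arc neighbourhood whose image
under suitable words has Haar measure tending to `0`. -/
def Contractive {k : ℕ} (g : Fin k → S1 ≃ₜ S1) : Prop :=
  ∀ x : S1, ∃ a b : ℝ, a < b ∧ b - a < 1 ∧
    x ∈ (fun t : ℝ => (t : S1)) '' Set.Ioo a b ∧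
    ∃ w : ℕ → List (Fin k),
      Tendsto (fun m => volume (applyWord g (w m) '' ((fun t : ℝ => (t : S1)) '' Set.Ioo a b)))
        atTop (𝓝 0)

/-- The Markov operator `P μ = ∑ᵢ pᵢ • (gᵢ)_* μ` of the IFS `(Γ, p)`. -/
def markovP {k : ℕ} (p : Fin k → ℝ) (g : Fin k → S1 ≃ₜ S1) (μ : Measure S1) : Measure S1 :=
  ∑ i : Fin k, ENNReal.ofReal (p i) • Measure.map (g i) μ

/-- The dual operator `P* f x = ∑ᵢ pᵢ f (gᵢ x)`. -/
def dualP {k : ℕ} (p : Fin k → ℝ) (g : Fin k → S1 ≃ₜ S1) (f : S1 → ℝ) (x : S1) : ℝ :=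
  ∑ i : Fin k, p i * f (g i x)

/-- Asymptotic stability of the IFS `(Γ, p)`: there is a unique invariant Borel probability
measure `μ*`, and `Pⁿ μ → μ*` weakly for every Borel probability measure `μ`. -/
def AsympStable {k : ℕ} (p : Fin k → ℝ) (g : Fin k → S1 ≃ₜ S1) : Prop :=
  ∃ μs : Measure S1, IsProbabilityMeasure μs ∧ markovP p g μs = μs ∧
    (∀ ν : Measure S1, IsProbabilityMeasure ν → markovP p g ν = ν → ν = μs) ∧
    ∀ μ : Measure S1, IsProbabilityMeasure μ → ∀ f : C(S1, ℝ),
      Tendsto (fun n => ∫ x, f x ∂((markovP p g)^[n] μ)) atTop (𝓝 (∫ x, f x ∂μs))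

theorem UnitAddCircle.exists_coe_eq_abs_sub_lt {w : S1} {c r : ℝ} (h : dist w (c : S1) < r) :
    ∃ t : ℝ, (t : S1) = w ∧ |t - c| < r := by
  obtain ⟨t, rfl⟩ := QuotientAddGroup.mk_surjective w
  have h1 : ‖((t - c : ℝ) : S1)‖ < r := by
    rw [AddCircle.coe_sub, ← dist_eq_norm]; exact h
  rw [UnitAddCircle.norm_eq] at h1
  refine ⟨t - round (t - c), ?_, ?_⟩
  · rw [AddCircle.coe_sub, sub_eq_self, AddCircle.coe_eq_zero_iff]
    exact ⟨round (t - c), by simp⟩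
  · convert h1 using 2
    ring

/-- Words of one fixed length in two rotations whose difference has infinite order move any point
`δ`-close to any other point. -/
theorem exists_length_rotations_dense {a b : S1} (hab : addOrderOf (a - b) = 0) {δ : ℝ}
    (hδ : 0 < δ) :
    ∃ N : ℕ, ∀ z w : S1, ∃ m n : ℕ, m + n = N ∧ dist (z + m • a + n • b) w < δ := by
  have hd := AddCircle.denseRange_zsmul_iff.2 hab
  obtain ⟨s, hs⟩ := isCompact_univ.elim_finite_subcover
    (fun k : ℤ => Metric.ball (k • (a - b)) δ) (fun _ => Metric.isOpen_ball) (by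
      intro x _
      obtain ⟨k, hk⟩ := hd.exists_dist_lt x hδ
      exact Set.mem_iUnion.2 ⟨k, hk⟩)
  obtain ⟨K, hK⟩ : ∃ K : ℕ, ∀ k ∈ s, k.natAbs ≤ K :=
    ⟨s.sup Int.natAbs, fun k hk => Finset.le_sup (f := Int.natAbs) hk⟩
  refine ⟨2 * K, fun z w => ?_⟩
  have hx := hs (Set.mem_univ (w - z - (2 * K : ℕ) • b - (K : ℤ) • (a - b)))
  simp only [Set.mem_iUnion, exists_prop] at hx
  obtain ⟨k, hks, hk⟩ := hx
  have hkK := hK k hks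
  obtain ⟨m, hm⟩ : ∃ m : ℕ, (m : ℤ) = k + K := ⟨(k + K).toNat, by omega⟩
  obtain ⟨n, hn⟩ : ∃ n : ℕ, m + n = 2 * K := ⟨2 * K - m, by omega⟩
  refine ⟨m, n, hn, ?_⟩
  rw [Metric.mem_ball, dist_comm, dist_eq_norm] at hk
  rw [dist_eq_norm]
  convert hk using 2
  have hk' : k = m - K := by omega
  rw [← hn, hk', add_smul, sub_smul, natCast_zsmul, smul_sub]
  abel

section Markov

variable {k : ℕ} {p : Fin k → ℝ} {g : Fin k → S1 ≃ₜ S1}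

theorem continuous_dualP_iterate {f : S1 → ℝ} (hf : Continuous f) (n : ℕ) :
    Continuous ((dualP p g)^[n] f) := by
  induction n with
  | zero => exact hf
  | succ n ih =>
    rw [Function.iterate_succ_apply']
    unfold dualP
    fun_prop

theorem dualP_le (hp : ∀ i, 0 < p i) (hsum : ∑ i, p i = 1) {f : S1 → ℝ} {K : ℝ}
    (hf : ∀ x, f x ≤ K) (x : S1) : dualP p g f x ≤ K := by
  calc dualP p g f x ≤ ∑ i, p i * K :=
        Finset.sum_le_sum fun i _ => mul_le_mul_of_nonneg_left (hf _) (hp i).le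
    _ = K := by rw [← Finset.sum_mul, hsum, one_mul]

theorem dualP_iterate_le (hp : ∀ i, 0 < p i) (hsum : ∑ i, p i = 1) {f : S1 → ℝ} {K : ℝ}
    (hf : ∀ x, f x ≤ K) (n : ℕ) (x : S1) : (dualP p g)^[n] f x ≤ K := by
  induction n generalizing x with
  | zero => exact hf x
  | succ n ih =>
    rw [Function.iterate_succ_apply']
    exact dualP_le hp hsum ih x

theorem dualP_iterate_neg (f : S1 → ℝ) (n : ℕ) :
    (dualP p g)^[n] (-f) = -(dualP p g)^[n] f := by
  induction n with
  | zero => rfl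
  | succ n ih =>
    rw [Function.iterate_succ_apply', ih, Function.iterate_succ_apply']
    ext x
    simp [dualP]

/-- If an average of values bounded by `K` is at least `K - η`, then so is, up to a factor, each
value entering the average. -/
theorem le_apply_of_le_dualP (hp : ∀ i, 0 < p i) (hsum : ∑ i, p i = 1) {f : S1 → ℝ} {K η q : ℝ}
    (hq : 0 < q) (hf : ∀ x, f x ≤ K) {x : S1} (hx : K - η ≤ dualP p g f x)
    {i : Fin k} (hqi : q ≤ p i) : K - η / q ≤ f (g i x) := by
  have h1 : p i * (K - f (g i x)) ≤ ∑ l, p l * (K - f (g l x)) :=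
    Finset.single_le_sum (f := fun l => p l * (K - f (g l x)))
      (fun l _ => mul_nonneg (hp l).le (sub_nonneg.2 (hf _))) (Finset.mem_univ i)
  have h2 : ∑ l, p l * (K - f (g l x)) = K - dualP p g f x := by
    simp only [mul_sub, Finset.sum_sub_distrib, ← Finset.sum_mul, hsum, one_mul, dualP]
  have h3 : q * (K - f (g i x)) ≤ η :=
    (mul_le_mul_of_nonneg_right hqi (sub_nonneg.2 (hf _))).trans (by linarith)
  have h4 : K - f (g i x) ≤ η / q := by rwa [le_div_iff₀ hq, mul_comm]
  linarith

theorem le_apply_rotation_of_le_dualP_iterate (hp : ∀ i, 0 < p i) (hsum : ∑ i, p i = 1)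
    {i j : Fin k} {a b : S1} (hi : ∀ x, g i x = x + a) (hj : ∀ x, g j x = x + b)
    {f : S1 → ℝ} {K q : ℝ} (hq : 0 < q) (hqi : q ≤ p i) (hqj : q ≤ p j) (hf : ∀ x, f x ≤ K)
    {m n : ℕ} {x : S1} {η : ℝ} (hx : K - η ≤ (dualP p g)^[m + n] f x) :
    K - η / q ^ (m + n) ≤ f (x + m • a + n • b) := by
  induction m generalizing x η with
  | zero =>
    rw [Nat.zero_add] at *
    induction n generalizing x η with
    | zero => simpa using hx
    | succ n ih =>
      rw [Function.iterate_succ_apply'] at hx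
      have h := le_apply_of_le_dualP hp hsum hq (dualP_iterate_le hp hsum hf n) hx hqj
      rw [hj] at h
      convert ih h using 2
      · rw [div_div, pow_succ']
      · rw [succ_nsmul']; abel
  | succ m ih =>
    rw [Nat.add_right_comm] at hx ⊢
    rw [Function.iterate_succ_apply'] at hx
    have h := le_apply_of_le_dualP hp hsum hq (dualP_iterate_le hp hsum hf _) hx hqi
    rw [hi] at h
    convert ih h using 2
    · rw [div_div, ← pow_succ']
    · rw [succ_nsmul']; abel

theorem isProbabilityMeasure_markovP (hp : ∀ i, 0 < p i) (hsum : ∑ i, p i = 1) (μ : Measure S1)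
    [IsProbabilityMeasure μ] : IsProbabilityMeasure (markovP p g μ) := by
  constructor
  have (i : Fin k) : Measure.map (g i) μ Set.univ = 1 := by
    rw [Measure.map_apply (g i).continuous.measurable MeasurableSet.univ]; simp
  simp only [markovP, Measure.coe_finsetSum, Finset.sum_apply, Measure.smul_apply, this,
    smul_eq_mul, mul_one]
  rw [← ENNReal.ofReal_sum_of_nonneg fun i _ => (hp i).le, hsum, ENNReal.ofReal_one]

theorem isProbabilityMeasure_markovP_iterate (hp : ∀ i, 0 < p i) (hsum : ∑ i, p i = 1)
    (μ : Measure S1) [IsProbabilityMeasure μ] (n : ℕ) :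
    IsProbabilityMeasure ((markovP p g)^[n] μ) := by
  induction n with
  | zero => assumption
  | succ n ih =>
    rw [Function.iterate_succ_apply']
    exact isProbabilityMeasure_markovP hp hsum _

theorem Continuous.integrable_S1 {f : S1 → ℝ} (hf : Continuous f) (μ : Measure S1)
    [IsFiniteMeasure μ] : Integrable f μ :=
  (BoundedContinuousFunction.mkOfCompact ⟨f, hf⟩).integrable μ

theorem integral_markovP (hp : ∀ i, 0 < p i) (μ : Measure S1) [IsFiniteMeasure μ] {f : S1 → ℝ}
    (hf : Continuous f) : ∫ x, f x ∂(markovP p g μ) = ∫ x, dualP p g f x ∂μ := by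
  unfold markovP dualP
  rw [integral_finsetSum_measure fun i _ => (hf.integrable_S1 _).smul_measure ENNReal.ofReal_ne_top,
    integral_finsetSum Finset.univ (f := fun i x => p i * f (g i x)) fun i _ =>
      ((hf.comp (g i).continuous).integrable_S1 μ).const_mul (p i)]
  refine Finset.sum_congr rfl fun i _ => ?_
  rw [integral_smul_measure, ENNReal.toReal_ofReal (hp i).le, smul_eq_mul, integral_const_mul,
    integral_map (g i).continuous.aemeasurable hf.aestronglyMeasurable]

theorem integral_markovP_iterate (hp : ∀ i, 0 < p i) (hsum : ∑ i, p i = 1) (μ : Measure S1)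
    [IsProbabilityMeasure μ] {f : S1 → ℝ} (hf : Continuous f) (n : ℕ) :
    ∫ x, f x ∂((markovP p g)^[n] μ) = ∫ x, (dualP p g)^[n] f x ∂μ := by
  induction n generalizing f with
  | zero => rfl
  | succ n ih =>
    have := isProbabilityMeasure_markovP_iterate (g := g) hp hsum μ n
    rw [Function.iterate_succ_apply', integral_markovP hp _ hf,
      ih (f := dualP p g f) (continuous_dualP_iterate hf 1), Function.iterate_succ_apply]

/-- Krylov–Bogolyubov: the Markov operator has an invariant probability measure. -/
theorem exists_invariant_probabilityMeasure (hp : ∀ i, 0 < p i) (hsum : ∑ i, p i = 1)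
    (g : Fin k → S1 ≃ₜ S1) :
    ∃ μ : Measure S1, IsProbabilityMeasure μ ∧ markovP p g μ = μ := by
  have hprob := isProbabilityMeasure_markovP_iterate (g := g) hp hsum (Measure.dirac 0)
  let ν : ℕ → Measure S1 := fun n =>
    ((n + 1 : ℕ) : ENNReal)⁻¹ • ∑ l ∈ Finset.range (n + 1), (markovP p g)^[l] (Measure.dirac 0)
  have hν (n : ℕ) : IsProbabilityMeasure (ν n) := by
    constructor
    simp only [ν, Measure.smul_apply, Measure.coe_finsetSum, Finset.sum_apply, measure_univ,
      Finset.sum_const, Finset.card_range, smul_eq_mul, nsmul_eq_mul, mul_one]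
    exact ENNReal.inv_mul_cancel (by simp) (ENNReal.natCast_ne_top _)
  have hint (n : ℕ) {f : S1 → ℝ} (hf : Continuous f) : ∫ x, f x ∂(ν n) =
      ((n + 1 : ℕ) : ℝ)⁻¹ *
        ∑ l ∈ Finset.range (n + 1), ∫ x, f x ∂((markovP p g)^[l] (Measure.dirac 0)) := by
    simp only [ν]
    rw [integral_smul_measure, integral_finsetSum_measure fun l _ => hf.integrable_S1 _]
    rw [ENNReal.toReal_inv, ENNReal.toReal_natCast, smul_eq_mul]
  let νP : ℕ → ProbabilityMeasure S1 := fun n => ⟨ν n, hν n⟩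
  obtain ⟨L, hF⟩ : ∃ L : ProbabilityMeasure S1, Tendsto νP (hyperfilter ℕ) (𝓝 L) :=
    ⟨_, ((hyperfilter ℕ).map νP).le_nhds_lim⟩
  refine ⟨L, inferInstance, ?_⟩
  rw [ProbabilityMeasure.tendsto_iff_forall_integral_tendsto] at hF
  have := isProbabilityMeasure_markovP (g := g) hp hsum (L : Measure S1)
  refine ext_of_forall_integral_eq_of_IsFiniteMeasure fun f => ?_
  rw [integral_markovP hp _ f.continuous]
  have hPf : Continuous (dualP p g f) := continuous_dualP_iterate f.continuous 1
  have h1 := (hF (BoundedContinuousFunction.mkOfCompact ⟨_, hPf⟩)).sub (hF f)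
  rw [← sub_eq_zero]
  refine tendsto_nhds_unique h1 ?_
  have h2 : Tendsto (fun n : ℕ => 2 * ‖f‖ * (1 / ((n : ℝ) + 1))) (hyperfilter ℕ) (𝓝 0) := by
    simpa using (tendsto_one_div_add_atTop_nhds_zero_nat.const_mul (2 * ‖f‖)).mono_left
      Nat.hyperfilter_le_atTop
  refine squeeze_zero_norm (fun n => ?_) h2
  change ‖∫ x, dualP p g f x ∂(ν n) - ∫ x, f x ∂(ν n)‖ ≤ _
  rw [hint n hPf, hint n f.continuous, ← mul_sub, ← Finset.sum_sub_distrib]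
  have h3 (l : ℕ) : ∫ x, dualP p g f x ∂((markovP p g)^[l] (Measure.dirac 0)) =
      ∫ x, f x ∂((markovP p g)^[l + 1] (Measure.dirac 0)) := by
    rw [Function.iterate_succ_apply', integral_markovP hp _ f.continuous]
  simp only [h3]
  rw [Finset.sum_range_sub fun l => ∫ x, f x ∂((markovP p g)^[l] (Measure.dirac 0)),
    norm_mul, mul_comm]
  have h4 (l : ℕ) : ‖∫ x, f x ∂((markovP p g)^[l] (Measure.dirac 0))‖ ≤ ‖f‖ :=
    f.norm_integral_le_norm _
  have h5 := norm_sub_le_of_le (h4 (n + 1)) (h4 0)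
  have h6 : ‖((n + 1 : ℕ) : ℝ)⁻¹‖ = 1 / ((n : ℝ) + 1) := by
    rw [Real.norm_of_nonneg (by positivity)]; simp
  rw [h6, two_mul]
  gcongr

/-- A measure stationary under the inverse maps is harmonic under the action on sets. -/
theorem measureReal_eq_sum_image (hp : ∀ i, 0 < p i) {m : Measure S1} [IsFiniteMeasure m]
    (hm : markovP p (fun i => (g i).symm) m = m) (A : Set S1) :
    m.real A = ∑ i, p i * m.real (g i '' A) := by
  have h (i : Fin k) : Measure.map (g i).symm m A = m (g i '' A) := by
    rw [(g i).image_eq_preimage_symm]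
    exact (g i).symm.toMeasurableEquiv.map_apply A
  conv_lhs => rw [← hm]
  simp only [Measure.real, markovP, Measure.coe_finsetSum, Finset.sum_apply, Measure.smul_apply,
    smul_eq_mul, h]
  rw [ENNReal.toReal_sum fun i _ => ENNReal.mul_ne_top ENNReal.ofReal_ne_top (measure_ne_top _ _)]
  simp [ENNReal.toReal_ofReal (hp _).le]

theorem mul_measureReal_image_le (hp : ∀ i, 0 < p i) {m : Measure S1} [IsFiniteMeasure m]
    (hm : markovP p (fun i => (g i).symm) m = m) {q : ℝ} {i : Fin k} (hqi : q ≤ p i)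
    (A : Set S1) : q * m.real (g i '' A) ≤ m.real A := by
  rw [measureReal_eq_sum_image hp hm A]
  exact (mul_le_mul_of_nonneg_right hqi measureReal_nonneg).trans
    (Finset.single_le_sum (f := fun i => p i * m.real (g i '' A))
      (fun l _ => mul_nonneg (hp l).le measureReal_nonneg) (Finset.mem_univ i))

theorem pow_mul_measureReal_image_le (hp : ∀ i, 0 < p i) {m : Measure S1} [IsFiniteMeasure m]
    (hm : markovP p (fun i => (g i).symm) m = m) {i j : Fin k} {a b : S1}
    (hi : ∀ x, g i x = x + a) (hj : ∀ x, g j x = x + b) {q : ℝ} (hq : 0 < q) (hqi : q ≤ p i)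
    (hqj : q ≤ p j) (r s : ℕ) (A : Set S1) :
    q ^ (r + s) * m.real ((fun z => z + r • a + s • b) '' A) ≤ m.real A := by
  induction r generalizing A with
  | zero =>
    induction s generalizing A with
    | zero => simp
    | succ s ih =>
      refine le_trans ?_ (mul_measureReal_image_le hp hm hqj A)
      refine le_trans (le_of_eq ?_) (mul_le_mul_of_nonneg_left (ih (g j '' A)) hq.le)
      rw [Set.image_image, ← mul_assoc, ← pow_succ']
      congr 2
      refine congrArg (fun F : S1 → S1 => F '' A) ?_
      ext z
      rw [hj, succ_nsmul']
      abel
  | succ r ih =>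
    refine le_trans ?_ (mul_measureReal_image_le hp hm hqi A)
    refine le_trans (le_of_eq ?_) (mul_le_mul_of_nonneg_left (ih (g i '' A)) hq.le)
    rw [Set.image_image, ← mul_assoc, ← pow_succ', Nat.add_right_comm]
    congr 2
    refine congrArg (fun F : S1 → S1 => F '' A) ?_
    ext z
    rw [hi, succ_nsmul']
    abel

theorem measureReal_singleton_eq_zero (hp : ∀ i, 0 < p i) (hsum : ∑ i, p i = 1)
    {i j : Fin k} {a b : S1} (hi : ∀ x, g i x = x + a) (hj : ∀ x, g j x = x + b)
    (hab : addOrderOf (a - b) = 0) {m : Measure S1} [IsProbabilityMeasure m]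
    (hm : markovP p (fun i => (g i).symm) m = m) (x : S1) : m.real {x} = 0 := by
  have hbdd : BddAbove (Set.range fun x => m.real {x}) :=
    ⟨1, by rintro _ ⟨x, rfl⟩; exact measureReal_le_one⟩
  have hfix : dualP p g (fun x => m.real {x}) = fun x => m.real {x} := by
    ext x
    rw [measureReal_eq_sum_image hp hm {x}]
    simp [dualP]
  set K := ⨆ x, m.real {x} with hK
  have hle (x : S1) : m.real {x} ≤ K := le_ciSup hbdd x
  refine le_antisymm ((hle x).trans ?_) measureReal_nonneg
  by_contra! hpos
  obtain ⟨q, hq, hqi, hqj⟩ : ∃ q, 0 < q ∧ q ≤ p i ∧ q ≤ p j :=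
    ⟨min (p i) (p j), lt_min (hp i) (hp j), min_le_left _ _, min_le_right _ _⟩
  obtain ⟨N, hN⟩ := exists_nat_gt (2 / K)
  obtain ⟨y, hy⟩ := exists_lt_of_lt_ciSup
    (show K - K / 2 * q ^ N < ⨆ x, m.real {x} by
      rw [← hK]; linarith [mul_pos (half_pos hpos) (pow_pos hq N)])
  have hmem (l : ℕ) (hl : l ∈ Finset.range (N + 1)) :
      K / 2 ≤ m.real {y + (N - l) • a + l • b} := by
    have hlN : N - l + l = N := Nat.sub_add_cancel (Nat.lt_succ_iff.1 (Finset.mem_range.1 hl))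
    have h := le_apply_rotation_of_le_dualP_iterate (m := N - l) (n := l) (x := y)
      (η := K / 2 * q ^ N) hp hsum hi hj hq hqi hqj hle
      (by rw [Function.iterate_fixed hfix]; exact hy.le)
    rw [hlN, mul_div_cancel_right₀ _ (pow_pos hq N).ne'] at h
    linarith
  have hinj : Set.InjOn (fun l : ℕ => y + (N - l) • a + l • b) (Finset.range (N + 1)) := by
    have hinj' := injective_nsmul_iff_not_isOfFinAddOrder.2 (addOrderOf_eq_zero_iff.1 hab)
    have hform (l : ℕ) (hl : l ≤ N) :
        y + (N - l) • a + l • b = y + N • a - l • (a - b) := by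
      conv_rhs => rw [← Nat.sub_add_cancel hl, add_nsmul, smul_sub]
      abel
    intro l hl l' hl' h
    rw [Finset.coe_range, Set.mem_Iio, Nat.lt_succ_iff] at hl hl'
    simp only [hform l hl, hform l' hl'] at h
    exact hinj' (sub_right_injective h)
  have h1 : m.real ((Finset.range (N + 1)).image fun l : ℕ => y + (N - l) • a + l • b) ≤ 1 :=
    measureReal_le_one
  rw [← sum_measureReal_singleton, Finset.sum_image hinj] at h1
  have h2 := (Finset.card_nsmul_le_sum _ _ _ hmem).trans h1
  rw [Finset.card_range, nsmul_eq_mul] at h2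
  rw [div_lt_iff₀ hpos] at hN
  push_cast at h2
  nlinarith

theorem exists_pos_le_measureReal_arc (hp : ∀ i, 0 < p i)
    {i j : Fin k} {a b : S1} (hi : ∀ x, g i x = x + a) (hj : ∀ x, g j x = x + b)
    (hab : addOrderOf (a - b) = 0) {m : Measure S1} [IsProbabilityMeasure m]
    (hm : markovP p (fun i => (g i).symm) m = m) {δ : ℝ} (hδ : 0 < δ) :
    ∃ c > 0, ∀ x y : ℝ, δ ≤ y - x → c ≤ m.real ((fun t : ℝ => (t : S1)) '' Set.Icc x y) := by
  obtain ⟨q, hq, hqi, hqj⟩ : ∃ q, 0 < q ∧ q ≤ p i ∧ q ≤ p j :=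
    ⟨min (p i) (p j), lt_min (hp i) (hp j), min_le_left _ _, min_le_right _ _⟩
  obtain ⟨N, hN⟩ := exists_length_rotations_dense hab (half_pos hδ)
  refine ⟨q ^ N / (N + 1), by positivity, fun x y hxy => ?_⟩
  set A := (fun t : ℝ => (t : S1)) '' Set.Icc x y
  have hcover : Set.univ ⊆
      ⋃ l ∈ Finset.range (N + 1), (fun z => z + (N - l) • a + l • b) '' A := by
    intro w _
    obtain ⟨r, s, hrs, hd⟩ := hN (((x + y) / 2 : ℝ) : S1) w
    have hd' : dist (w - r • a - s • b) (((x + y) / 2 : ℝ) : S1) < δ / 2 := by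
      rw [dist_comm, dist_eq_norm] at hd
      rw [dist_eq_norm]
      convert hd using 2
      abel
    obtain ⟨t, ht, htd⟩ := UnitAddCircle.exists_coe_eq_abs_sub_lt hd'
    rw [abs_lt] at htd
    simp only [Set.mem_iUnion, Finset.mem_range]
    refine ⟨s, by omega, t, ⟨t, ⟨by linarith, by linarith⟩, rfl⟩, ?_⟩
    rw [← hrs, Nat.add_sub_cancel]
    simp only [ht]
    abel
  have h1 : (1 : ℝ) ≤ ∑ l ∈ Finset.range (N + 1),
      m.real ((fun z => z + (N - l) • a + l • b) '' A) := by
    refine (probReal_univ (μ := m)).symm.le.trans ?_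
    exact (measureReal_mono hcover (measure_ne_top _ _)).trans (measureReal_biUnion_finset_le _ _)
  have h2 : q ^ N ≤ ∑ l ∈ Finset.range (N + 1), m.real A := by
    calc q ^ N ≤ q ^ N * ∑ l ∈ Finset.range (N + 1),
          m.real ((fun z => z + (N - l) • a + l • b) '' A) :=
          le_mul_of_one_le_right (pow_pos hq N).le h1
      _ ≤ _ := by
        rw [Finset.mul_sum]
        refine Finset.sum_le_sum fun l hl => ?_
        have hlN : N - l + l = N :=
          Nat.sub_add_cancel (Nat.lt_succ_iff.1 (Finset.mem_range.1 hl))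
        simpa only [hlN] using pow_mul_measureReal_image_le hp hm hi hj hq hqi hqj (N - l) l A
  rw [Finset.sum_const, Finset.card_range, nsmul_eq_mul] at h2
  rw [div_le_iff₀ (by positivity), mul_comm]
  exact_mod_cast h2

/-- The bound by the mass of an arc propagates along the dual iterates, since that mass is
harmonic. -/
theorem exists_abs_dualP_iterate_sub_le (hg : ∀ i, IsOPH (g i)) (hp : ∀ i, 0 < p i)
    (hsum : ∑ i, p i = 1) {i j : Fin k} {a b : S1} (hi : ∀ x, g i x = x + a)
    (hj : ∀ x, g j x = x + b) (hab : addOrderOf (a - b) = 0) {m : Measure S1}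
    [IsProbabilityMeasure m] (hm : markovP p (fun i => (g i).symm) m = m) {f : S1 → ℝ}
    (hf : Continuous f) {ε : ℝ} (hε : 0 < ε) :
    ∃ C ≥ 0, ∀ n : ℕ, ∀ x y : ℝ, x ≤ y → |(dualP p g)^[n] f x - (dualP p g)^[n] f y| ≤
      ε + C * m.real ((fun t : ℝ => (t : S1)) '' Set.Icc x y) := by
  obtain ⟨δ, hδ, hfδ⟩ := Metric.uniformContinuous_iff.1
    (CompactSpace.uniformContinuous_of_continuous hf) ε hε
  obtain ⟨c, hc, hcm⟩ := exists_pos_le_measureReal_arc hp hi hj hab hm hδ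
  obtain ⟨B, hB⟩ := (isCompact_range hf).isBounded.exists_norm_le
  have hB0 : 0 ≤ B := (norm_nonneg _).trans (hB _ ⟨0, rfl⟩)
  refine ⟨2 * B / c, by positivity, fun n => ?_⟩
  induction n with
  | zero =>
    intro x y hxy
    change |f x - f y| ≤ _
    have h0 : 0 ≤ 2 * B / c * m.real ((fun t : ℝ => (t : S1)) '' Set.Icc x y) := by positivity
    rcases lt_or_ge (y - x) δ with h | h
    · have hd : dist (x : S1) (y : S1) < δ := by
        rw [dist_comm, dist_eq_norm, ← AddCircle.coe_sub]
        refine lt_of_le_of_lt ?_ h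
        rw [UnitAddCircle.norm_eq]
        refine (round_le (y - x) 0).trans ?_
        rw [Int.cast_zero, sub_zero, abs_of_nonneg (sub_nonneg.2 hxy)]
      have := (hfδ hd).le
      rw [Real.dist_eq] at this
      linarith
    · have h1 : |f x - f y| ≤ 2 * B := by
        rw [two_mul]
        exact norm_sub_le_of_le (hB _ ⟨_, rfl⟩) (hB _ ⟨_, rfl⟩)
      have h2 : 2 * B = 2 * B / c * c := by field_simp
      have h3 := mul_le_mul_of_nonneg_left (hcm x y h) (by positivity : 0 ≤ 2 * B / c)
      linarith
  | succ n ih =>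
    intro x y hxy
    rw [Function.iterate_succ_apply', measureReal_eq_sum_image hp hm]
    simp only [dualP]
    rw [← Finset.sum_sub_distrib]
    have hε' : ε = ∑ i, p i * ε := by rw [← Finset.sum_mul, hsum, one_mul]
    rw [hε', Finset.mul_sum, ← Finset.sum_add_distrib]
    refine (Finset.abs_sum_le_sum_abs _ _).trans (Finset.sum_le_sum fun l _ => ?_)
    obtain ⟨G, hGm, hGc, -, hG⟩ := hg l
    rw [← mul_sub, abs_mul, abs_of_pos (hp l), hG, hG, mul_left_comm _ (p l), ← mul_add]
    refine mul_le_mul_of_nonneg_left ((ih _ _ (hGm.monotone hxy)).trans ?_) (hp l).le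
    gcongr
    · exact measure_ne_top _ _
    rintro _ ⟨t, ht, rfl⟩
    obtain ⟨s, hs, rfl⟩ := intermediate_value_Icc hxy hGc.continuousOn ht
    exact ⟨s, ⟨s, hs, rfl⟩, hG s⟩

theorem uniformEquicontinuous_dualP_iterate (hg : ∀ i, IsOPH (g i)) (hp : ∀ i, 0 < p i)
    (hsum : ∑ i, p i = 1) {i j : Fin k} {a b : S1} (hi : ∀ x, g i x = x + a)
    (hj : ∀ x, g j x = x + b) (hab : addOrderOf (a - b) = 0) {f : S1 → ℝ} (hf : Continuous f) :
    UniformEquicontinuous fun n : ℕ => (dualP p g)^[n] f := by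
  obtain ⟨m, hmp, hm⟩ := exists_invariant_probabilityMeasure hp hsum fun i => (g i).symm
  refine CompactSpace.uniformEquicontinuous_of_equicontinuous fun x₀ => ?_
  rw [Metric.equicontinuousAt_iff]
  intro ε hε
  obtain ⟨C, hC, hCm⟩ := exists_abs_dualP_iterate_sub_le hg hp hsum hi hj hab hm hf (half_pos hε)
  have hatom : m {x₀} < ENNReal.ofReal (ε / 2 / (C + 1)) := by
    have := measureReal_singleton_eq_zero hp hsum hi hj hab hm x₀
    rw [measureReal_eq_zero_iff] at this
    rw [this, ENNReal.ofReal_pos]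
    positivity
  obtain ⟨U, hxU, hU, hmU⟩ := Set.exists_isOpen_lt_of_lt _ _ hatom
  have hmU' : m.real U < ε / 2 / (C + 1) :=
    (ENNReal.lt_ofReal_iff_toReal_lt (measure_ne_top _ _)).1 hmU
  obtain ⟨t₀, rfl⟩ := QuotientAddGroup.mk_surjective x₀
  obtain ⟨r, hr, hrU⟩ := Metric.isOpen_iff.1 (hU.preimage (AddCircle.continuous_mk' (1 : ℝ))) t₀
    (hxU rfl)
  have hsub {x y : ℝ} (hx : |x - t₀| < r) (hy : |y - t₀| < r) :
      (fun t : ℝ => (t : S1)) '' Set.Icc x y ⊆ U := by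
    rintro _ ⟨t, ht, rfl⟩
    rw [abs_lt] at hx hy
    refine hrU ?_
    rw [Metric.mem_ball, Real.dist_eq, abs_lt]
    exact ⟨by linarith [ht.1], by linarith [ht.2]⟩
  have hmain {x y : ℝ} (hx : |x - t₀| < r) (hy : |y - t₀| < r) (hxy : x ≤ y) (n : ℕ) :
      |(dualP p g)^[n] f x - (dualP p g)^[n] f y| < ε := by
    have h1 : m.real ((fun t : ℝ => (t : S1)) '' Set.Icc x y) < ε / 2 / (C + 1) :=
      (measureReal_mono (hsub hx hy)).trans_lt hmU'
    rw [lt_div_iff₀ (by positivity)] at h1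
    have h2 := hCm n x y hxy
    have h3 : 0 ≤ m.real ((fun t : ℝ => (t : S1)) '' Set.Icc x y) := measureReal_nonneg
    linarith
  refine ⟨r, hr, fun x hx n => ?_⟩
  obtain ⟨t, rfl, ht⟩ := UnitAddCircle.exists_coe_eq_abs_sub_lt hx
  have ht₀ : |t₀ - t₀| < r := by simpa using hr
  rcases le_total t₀ t with h | h
  · exact hmain ht₀ ht h n
  · rw [dist_comm]
    exact hmain ht ht₀ h n

theorem eventually_dualP_iterate_le (hg : ∀ i, IsOPH (g i)) (hp : ∀ i, 0 < p i)
    (hsum : ∑ i, p i = 1) {i j : Fin k} {a b : S1} (hi : ∀ x, g i x = x + a)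
    (hj : ∀ x, g j x = x + b) (hab : addOrderOf (a - b) = 0) {μ : Measure S1}
    [IsProbabilityMeasure μ] (hμ : markovP p g μ = μ) {f : S1 → ℝ} (hf : Continuous f)
    {ε : ℝ} (hε : 0 < ε) :
    ∀ᶠ n in atTop, ∀ x, (dualP p g)^[n] f x ≤ ∫ x, f x ∂μ + ε := by
  set u : ℕ → S1 → ℝ := fun n => (dualP p g)^[n] f
  have hu (n : ℕ) : Continuous (u n) := continuous_dualP_iterate hf n
  have hadd (n l : ℕ) : u (n + l) = (dualP p g)^[n] (u l) := Function.iterate_add_apply _ _ _ _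
  have hint (n : ℕ) : ∫ x, u n x ∂μ = ∫ x, f x ∂μ := by
    rw [← integral_markovP_iterate hp hsum μ hf n, Function.iterate_fixed hμ]
  have hbdd (n : ℕ) : BddAbove (Set.range (u n)) := (isCompact_range (hu n)).bddAbove
  have hle (n : ℕ) (x : S1) : u n x ≤ ⨆ y, u n y := le_ciSup (hbdd n) x
  have hlow (n : ℕ) {K : ℝ} (hK : ∀ x, K ≤ u n x) : K ≤ ∫ x, f x ∂μ := by
    rw [← hint n]
    simpa using integral_mono (integrable_const K) ((hu n).integrable_S1 μ) hK
  have hupp (n : ℕ) : ∫ x, f x ∂μ ≤ ⨆ y, u n y := by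
    rw [← hint n]
    simpa using integral_mono ((hu n).integrable_S1 μ) (integrable_const _) (hle n)
  have hs : BddBelow (Set.range fun n => ⨆ y, u n y) :=
    ⟨_, by rintro _ ⟨n, rfl⟩; exact hupp n⟩
  obtain ⟨δ, hδ, huδ⟩ := Metric.uniformEquicontinuous_iff.1
    (uniformEquicontinuous_dualP_iterate hg hp hsum hi hj hab hf) (ε / 2) (half_pos hε)
  obtain ⟨N, hN⟩ := exists_length_rotations_dense hab hδ
  obtain ⟨q, hq, hqi, hqj⟩ : ∃ q, 0 < q ∧ q ≤ p i ∧ q ≤ p j :=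
    ⟨min (p i) (p j), lt_min (hp i) (hp j), min_le_left _ _, min_le_right _ _⟩
  obtain ⟨n, hn⟩ := exists_lt_of_ciInf_lt
    (lt_add_of_pos_right (⨅ n, ⨆ y, u n y) (mul_pos (half_pos hε) (pow_pos hq N)))
  obtain ⟨x, -, hx⟩ := isCompact_univ.exists_isMaxOn Set.univ_nonempty (hu (N + n)).continuousOn
  have hxs : (⨆ y, u n y) - ε / 2 * q ^ N ≤ u (N + n) x := by
    have h1 := ciInf_le hs (N + n)
    have h2 : ⨆ y, u (N + n) y ≤ u (N + n) x := ciSup_le fun y => hx (Set.mem_univ y)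
    linarith
  have hall (w : S1) : (⨆ y, u n y) - ε ≤ u n w := by
    obtain ⟨r, s, hrs, hd⟩ := hN x w
    rw [hadd, ← hrs] at hxs
    have h1 := le_apply_rotation_of_le_dualP_iterate hp hsum hi hj hq hqi hqj (hle n) hxs
    rw [mul_div_cancel_right₀ _ (pow_pos hq _).ne'] at h1
    have h2 := huδ _ _ hd n
    rw [Real.dist_eq, abs_lt] at h2
    change _ < u n _ - u n w ∧ u n _ - u n w < _ at h2
    linarith [h2.2]
  filter_upwards [eventually_ge_atTop n] with l hl y
  obtain ⟨d, rfl⟩ := Nat.exists_eq_add_of_le' hl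
  change u (d + n) y ≤ _
  rw [hadd]
  exact (dualP_iterate_le hp hsum (hle n) d y).trans (by linarith [hlow n hall])

end Markov

/-- If `Γ` contains two rotations `T_α` and `T_β` with `α - β` irrational,
then the IFS `(Γ, p)` is asymptotically stable for any strictly positive probability vector. -/
theorem two_rotations_irrational_difference_asymptotically_stable {k : ℕ}
    (g : Fin k → S1 ≃ₜ S1) (hg : ∀ i, IsOPH (g i))
    (i j : Fin k) (α β : ℝ)
    (hi : ∀ x : S1, g i x = x + ((α : ℝ) : S1))
    (hj : ∀ x : S1, g j x = x + ((β : ℝ) : S1))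
    (hirr : Irrational (α - β))
    (p : Fin k → ℝ) (hp : ∀ i, 0 < p i) (hsum : ∑ i, p i = 1) :
    AsympStable p g := by
  obtain ⟨μs, hprob, hinv⟩ := exists_invariant_probabilityMeasure hp hsum g
  have hab : addOrderOf ((α : S1) - (β : S1)) = 0 := by
    rw [← AddCircle.coe_sub, ← AddCircle.denseRange_zsmul_iff, AddCircle.denseRange_zsmul_coe_iff,
      div_one]
    exact hirr
  have hconv (μ : Measure S1) (hμ : IsProbabilityMeasure μ) (f : S1 → ℝ) (hf : Continuous f) :
      Tendsto (fun n => ∫ x, f x ∂((markovP p g)^[n] μ)) atTop (𝓝 (∫ x, f x ∂μs)) := by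
    rw [Metric.tendsto_nhds]
    intro ε hε
    filter_upwards [eventually_dualP_iterate_le hg hp hsum hi hj hab hinv hf (half_pos hε),
      eventually_dualP_iterate_le hg hp hsum hi hj hab hinv hf.neg (half_pos hε)] with n h1 h2
    rw [integral_markovP_iterate hp hsum μ hf]
    have hint := (continuous_dualP_iterate (p := p) (g := g) hf n).integrable_S1 μ
    change ∀ x, (dualP p g)^[n] (-f) x ≤ ∫ x, -f x ∂μs + ε / 2 at h2
    rw [dualP_iterate_neg, integral_neg] at h2
    have h3 := integral_mono hint (integrable_const _) h1
    have h4 := integral_mono hint.neg (integrable_const _) h2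
    simp only [Pi.neg_apply, integral_neg, integral_const, probReal_univ, one_smul] at h3 h4
    rw [Real.dist_eq, abs_lt]
    constructor <;> linarith
  refine ⟨μs, hprob, hinv, fun ν hν hνinv => ?_, fun μ hμ f => hconv μ hμ f f.continuous⟩
  refine ext_of_forall_integral_eq_of_IsFiniteMeasure fun f => ?_
  refine tendsto_nhds_unique ?_ (hconv ν hν f f.continuous)
  simp only [Function.iterate_fixed hνinv]
  exact tendsto_const_nhds
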